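/- (Equivalence of Dirichlet forms, first estimate.) Let s : ℤ → ℝ be a symmetric transition probability with finite second moment σ², let μ_{1/2} be the Bernoulli product measure of density 1/2 on Ω = {0,1}^ℤ, and let h ∈ L²(μ_{1/2}). Define 𝒟(h) := (1/2) ∑_{x∈ℤ} I_{x,x+1}(h) and ⟨h, −Sh⟩ := (1/2) ∑_{x∈ℤ} ∑_{z>0} s(z) I_{x,x+z}(h) (values in [0,∞]). Then ⟨h, −Sh⟩ ≤ 4 σ² 𝒟(h); equivalently, with C₁ := 1/(4σ²), C₁ ⟨h, −Sh⟩ ≤ 𝒟(h). -/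

import Mathlib

open MeasureTheory

/-- The configuration obtained from `η` by exchanging the values at `x` and `y`. -/
def swapConf (x y : ℤ) (η : ℤ → Bool) : ℤ → Bool :=
  fun w => if w = x then η y else if w = y then η x else η w

/-- `I_{x,y}(h) = ∫ (h(η^{x,y}) − h(η))² dμ`. -/
noncomputable def Ixy (μ : Measure (ℤ → Bool)) (h : (ℤ → Bool) → ℝ) (x y : ℤ) : ℝ :=
  ∫ η, (h (swapConf x y η) - h η) ^ 2 ∂μ

/-- The Dirichlet form `𝒟(h) = ½ ∑_{x∈ℤ} I_{x,x+1}(h)`, with values in `[0,∞]`. -/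
noncomputable def dirichletForm (μ : Measure (ℤ → Bool)) (h : (ℤ → Bool) → ℝ) : ENNReal :=
  (1 / 2 : ENNReal) * ∑' x : ℤ, ENNReal.ofReal (Ixy μ h x (x + 1))

/-- `⟨h, −Sh⟩ = ½ ∑_{x∈ℤ} ∑_{z>0} s(z) I_{x,x+z}(h)`, with values in `[0,∞]`. -/
noncomputable def genForm (s : ℤ → ℝ) (μ : Measure (ℤ → Bool)) (h : (ℤ → Bool) → ℝ) : ENNReal :=
  (1 / 2 : ENNReal) * ∑' x : ℤ, ∑' z : ℕ,
    ENNReal.ofReal (s ((z : ℤ) + 1)) * ENNReal.ofReal (Ixy μ h x (x + ((z : ℤ) + 1)))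

theorem swapConf_eq (x y : ℤ) (η : ℤ → Bool) : swapConf x y η = fun w => η (Equiv.swap x y w) := by
  funext w
  simp only [swapConf, Equiv.swap_apply_def]
  split_ifs <;> rfl

theorem swapConf_meas (x y : ℤ) : Measurable (swapConf x y) := by
  have : swapConf x y = fun η w => η (Equiv.swap x y w) := by
    funext η; exact swapConf_eq x y η
  rw [this]
  exact measurable_pi_lambda _ (fun w => measurable_pi_apply _)

theorem swapConf_mp (μ : Measure (ℤ → Bool)) [IsProbabilityMeasure μ]
    (hμ : ∀ (S : Finset ℤ) (b : ℤ → Bool),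
      μ {η | ∀ x ∈ S, η x = b x} = (1 / 2 : ENNReal) ^ S.card) (x y : ℤ) :
    MeasurePreserving (swapConf x y) μ μ := by
  refine ⟨swapConf_meas x y, ?_⟩
  have key : ∀ I : Finset ℤ, (μ.map (swapConf x y)).map I.restrict = μ.map I.restrict := by
    intro I
    apply Measure.ext_of_singleton
    intro a
    have hr : Measurable (I.restrict (π := fun _ : ℤ => Bool)) :=
      measurable_pi_lambda _ (fun _ => measurable_pi_apply _)
    rw [Measure.map_apply hr (measurableSet_singleton a),
      Measure.map_apply hr (measurableSet_singleton a),
      Measure.map_apply (swapConf_meas x y) (hr (measurableSet_singleton a))]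
    classical
    let b : ℤ → Bool := fun w => if hw : w ∈ I then a ⟨w, hw⟩ else false
    have e1 : I.restrict (π := fun _ : ℤ => Bool) ⁻¹' {a} = {η | ∀ x ∈ I, η x = b x} := by
      ext η
      simp only [Set.mem_preimage, Set.mem_singleton_iff, Set.mem_ofPred_eq, funext_iff,
        Subtype.forall, Finset.restrict]
      refine forall_congr' fun w => forall_congr' fun hw => ?_
      simp [b, hw]
    have e2 : swapConf x y ⁻¹' {η | ∀ x ∈ I, η x = b x} =
        {η | ∀ w ∈ I.map (Equiv.swap x y).toEmbedding, η w = b (Equiv.swap x y w)} := by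
      ext η
      simp [swapConf_eq]
      constructor
      · intro H w hw
        simpa using H _ hw
      · intro H w hw
        simpa using H (Equiv.swap x y w) (by simpa using hw)
    rw [e1, e2, hμ, hμ I b]
    simp
  have : IsProbabilityMeasure (μ.map (swapConf x y)) :=
    Measure.isProbabilityMeasure_map (swapConf_meas x y).aemeasurable
  have hf : ∀ I : Finset ℤ, IsFiniteMeasure (μ.map (I.restrict (π := fun _ : ℤ => Bool))) :=
    fun I => inferInstance
  exact IsProjectiveLimit.unique (P := fun I : Finset ℤ => μ.map I.restrict) key (fun I => rfl)

theorem swapConf_conj (x y : ℤ) (hxy : x < y) (η : ℤ → Bool) :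
    swapConf x (y + 1) η =
      swapConf y (y + 1) (swapConf x y (swapConf y (y + 1) η)) := by
  funext w
  simp only [swapConf]
  split_ifs <;> first | rfl | omega | grind

noncomputable def dN (μ : Measure (ℤ → Bool)) (h : (ℤ → Bool) → ℝ) (x y : ℤ) : ℝ :=
  (eLpNorm (fun η => h (swapConf x y η) - h η) 2 μ).toReal

section
variable (μ : Measure (ℤ → Bool)) (h : (ℤ → Bool) → ℝ)
  (hmp : ∀ x y, MeasurePreserving (swapConf x y) μ μ) (hh : MemLp h 2 μ)

theorem diff_memLp (hmp : ∀ x y, MeasurePreserving (swapConf x y) μ μ) (hh : MemLp h 2 μ)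
    (x y : ℤ) : MemLp (fun η => h (swapConf x y η) - h η) 2 μ :=
  (hh.comp_measurePreserving (hmp x y)).sub hh

theorem Ixy_eq (hmp : ∀ x y, MeasurePreserving (swapConf x y) μ μ) (hh : MemLp h 2 μ)
    (x y : ℤ) : Ixy μ h x y = dN μ h x y ^ 2 := by
  have hm := diff_memLp μ h hmp hh x y
  have h0 : 0 ≤ Ixy μ h x y := integral_nonneg fun _ => sq_nonneg _
  rw [dN, hm.eLpNorm_eq_integral_rpow_norm (by norm_num) (by norm_num)]
  have : ∫ a, ‖h (swapConf x y a) - h a‖ ^ (2 : ENNReal).toReal ∂μ = Ixy μ h x y := by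
    unfold Ixy
    congr 1
    funext a
    simp
  rw [this, ENNReal.toReal_ofReal (Real.rpow_nonneg h0 _)]
  simp only [ENNReal.toReal_ofNat]
  rw [← Real.rpow_natCast, ← Real.rpow_mul h0]
  norm_num

theorem dN_step (hmp : ∀ x y, MeasurePreserving (swapConf x y) μ μ) (hh : MemLp h 2 μ)
    (x y : ℤ) (hxy : x < y) :
    dN μ h x (y + 1) ≤ dN μ h x y + 2 * dN μ h y (y + 1) := by
  have m1 := diff_memLp μ h hmp hh y (y + 1)
  have m2 := diff_memLp μ h hmp hh x y
  have c2 := m2.comp_measurePreserving (hmp y (y + 1))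
  have c1 := (m1.comp_measurePreserving (hmp x y)).comp_measurePreserving (hmp y (y + 1))
  have n2 := eLpNorm_comp_measurePreserving (p := 2) m2.1 (hmp y (y + 1))
  have n1 := (eLpNorm_comp_measurePreserving (p := 2)
    (m1.comp_measurePreserving (hmp x y)).1 (hmp y (y + 1))).trans
    (eLpNorm_comp_measurePreserving (p := 2) m1.1 (hmp x y))
  have e : (fun η => h (swapConf x (y + 1) η) - h η) =
      ((((fun η => h (swapConf y (y + 1) η) - h η) ∘ swapConf x y) ∘ swapConf y (y + 1)) +
        ((fun η => h (swapConf x y η) - h η) ∘ swapConf y (y + 1))) +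
        (fun η => h (swapConf y (y + 1) η) - h η) := by
    funext η
    simp only [Pi.add_apply, Function.comp]
    rw [swapConf_conj x y hxy η]
    ring
  have t1 := eLpNorm_add_le (p := 2) (c1.add c2).1 m1.1 (by norm_num)
  have t2 := eLpNorm_add_le (p := 2) c1.1 c2.1 (by norm_num)
  rw [← e] at t1
  have t3 := t1.trans (add_le_add_left t2 _)
  rw [n1, n2] at t3
  have f1 := m1.eLpNorm_ne_top
  have f2 := m2.eLpNorm_ne_top
  have t4 := ENNReal.toReal_mono (by simp [f1, f2]) t3
  rw [ENNReal.toReal_add (by simp [f1, f2]) f1, ENNReal.toReal_add f1 f2] at t4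
  unfold dN
  linarith

theorem dN_sum (hmp : ∀ x y, MeasurePreserving (swapConf x y) μ μ) (hh : MemLp h 2 μ)
    (x : ℤ) (n : ℕ) :
    dN μ h x (x + ((n : ℤ) + 1)) ≤
      2 * ∑ i ∈ Finset.range (n + 1), dN μ h (x + i) (x + i + 1) := by
  induction n with
  | zero =>
    have : 0 ≤ dN μ h x (x + 1) := ENNReal.toReal_nonneg
    simp
    linarith
  | succ n ih =>
    rw [Finset.sum_range_succ, mul_add]
    have := dN_step μ h hmp hh x (x + ((n : ℤ) + 1)) (by omega)
    push_cast
    rw [← add_assoc x]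
    linarith

theorem Ixy_le (hmp : ∀ x y, MeasurePreserving (swapConf x y) μ μ) (hh : MemLp h 2 μ)
    (x : ℤ) (n : ℕ) :
    Ixy μ h x (x + ((n : ℤ) + 1)) ≤
      4 * ((n : ℝ) + 1) * ∑ i ∈ Finset.range (n + 1), Ixy μ h (x + i) (x + i + 1) := by
  simp only [Ixy_eq μ h hmp hh]
  have h1 := dN_sum μ h hmp hh x n
  have h0 : 0 ≤ dN μ h x (x + ((n : ℤ) + 1)) := ENNReal.toReal_nonneg
  have h2 := sq_sum_le_card_mul_sum_sq (s := Finset.range (n + 1))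
    (f := fun i : ℕ => dN μ h (x + i) (x + i + 1))
  simp only [Finset.card_range] at h2
  push_cast at h2
  have h3 := pow_le_pow_left₀ h0 h1 2
  nlinarith

theorem tsum_Ixy_le (hmp : ∀ x y, MeasurePreserving (swapConf x y) μ μ) (hh : MemLp h 2 μ)
    (n : ℕ) :
    ∑' x : ℤ, ENNReal.ofReal (Ixy μ h x (x + ((n : ℤ) + 1))) ≤
      ENNReal.ofReal (4 * ((n : ℝ) + 1) ^ 2) *
        ∑' x : ℤ, ENNReal.ofReal (Ixy μ h x (x + 1)) := by
  have hI : ∀ x y, 0 ≤ Ixy μ h x y := fun x y => integral_nonneg fun _ => sq_nonneg _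
  calc ∑' x : ℤ, ENNReal.ofReal (Ixy μ h x (x + ((n : ℤ) + 1)))
      ≤ ∑' x : ℤ, ENNReal.ofReal (4 * ((n : ℝ) + 1)) *
        ∑ i ∈ Finset.range (n + 1), ENNReal.ofReal (Ixy μ h (x + i) (x + i + 1)) := by
        refine ENNReal.tsum_le_tsum fun x => ?_
        rw [← ENNReal.ofReal_sum_of_nonneg (fun _ _ => hI _ _),
          ← ENNReal.ofReal_mul (by positivity)]
        exact ENNReal.ofReal_le_ofReal (Ixy_le μ h hmp hh x n)
    _ = ENNReal.ofReal (4 * ((n : ℝ) + 1)) * ∑ i ∈ Finset.range (n + 1),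
          ∑' x : ℤ, ENNReal.ofReal (Ixy μ h (x + i) (x + i + 1)) := by
        rw [ENNReal.tsum_mul_left, Summable.tsum_finsetSum (fun _ _ => ENNReal.summable)]
    _ = ENNReal.ofReal (4 * ((n : ℝ) + 1)) * ∑ i ∈ Finset.range (n + 1),
          ∑' x : ℤ, ENNReal.ofReal (Ixy μ h x (x + 1)) := by
        congr 1
        refine Finset.sum_congr rfl fun i _ => ?_
        exact (Equiv.addRight (i : ℤ)).tsum_eq
          (fun x : ℤ => ENNReal.ofReal (Ixy μ h x (x + 1)))
    _ = _ := by
        rw [Finset.sum_const, Finset.card_range, nsmul_eq_mul, ← mul_assoc]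
        congr 1
        rw [← ENNReal.ofReal_natCast, ← ENNReal.ofReal_mul (by positivity)]
        congr 1
        push_cast
        ring

end

/-- Equivalence of Dirichlet forms, first estimate: `⟨h, −Sh⟩ ≤ 4σ² 𝒟(h)`. -/
theorem stmt_6 (s : ℤ → ℝ) (hpos : ∀ z, 0 ≤ s z) (hsym : ∀ z, s (-z) = s z)
    (hzero : s 0 = 0) (hprob : HasSum s 1)
    (hmom : Summable fun z : ℤ => (z : ℝ) ^ 2 * s z)
    (σ2 : ℝ) (hσ2 : σ2 = ∑' z : ℤ, (z : ℝ) ^ 2 * s z) (hσ2pos : 0 < σ2)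
    (μ : Measure (ℤ → Bool)) [IsProbabilityMeasure μ]
    (hμ : ∀ (S : Finset ℤ) (b : ℤ → Bool),
      μ {η | ∀ x ∈ S, η x = b x} = (1 / 2 : ENNReal) ^ S.card)
    (h : (ℤ → Bool) → ℝ) (hh : MemLp h 2 μ) :
    genForm s μ h ≤ ENNReal.ofReal (4 * σ2) * dirichletForm μ h := by
  have hmp := swapConf_mp μ hμ
  unfold genForm dirichletForm
  rw [mul_left_comm]
  gcongr
  rw [ENNReal.tsum_comm]
  set T := ∑' x : ℤ, ENNReal.ofReal (Ixy μ h x (x + 1)) with hT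
  have hb : ∀ n : ℕ, ∑' x : ℤ, ENNReal.ofReal (Ixy μ h x (x + ((n : ℤ) + 1))) ≤
      ENNReal.ofReal (4 * ((n : ℝ) + 1) ^ 2) * T := tsum_Ixy_le μ h hmp hh
  clear_value T
  have hnn : ∀ z : ℤ, 0 ≤ (z : ℝ) ^ 2 * s z := fun z => mul_nonneg (sq_nonneg _) (hpos z)
  calc _ ≤ ∑' z : ℕ, ENNReal.ofReal (s ((z : ℤ) + 1)) *
        (ENNReal.ofReal (4 * ((z : ℝ) + 1) ^ 2) * T) := by
        refine ENNReal.tsum_le_tsum fun z => ?_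
        rw [ENNReal.tsum_mul_left]
        gcongr
        exact hb z
    _ = ENNReal.ofReal 4 * (∑' z : ℕ, (fun w : ℤ => ENNReal.ofReal ((w : ℝ) ^ 2 * s w))
          ((z : ℤ) + 1)) * T := by
        rw [← ENNReal.tsum_mul_left, ← ENNReal.tsum_mul_right]
        refine tsum_congr fun z => ?_
        rw [← mul_assoc, ← ENNReal.ofReal_mul (hpos _), ← ENNReal.ofReal_mul (by norm_num)]
        congr 2
        push_cast
        ring
    _ ≤ ENNReal.ofReal 4 * (∑' w : ℤ, ENNReal.ofReal ((w : ℝ) ^ 2 * s w)) * T := by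
        gcongr
        exact ENNReal.tsum_comp_le_tsum_of_injective
          (f := fun z : ℕ => (z : ℤ) + 1) (fun a b hab => by simpa using hab) _
    _ = _ := by
        rw [← ENNReal.ofReal_tsum_of_nonneg hnn hmom, ← hσ2, ← ENNReal.ofReal_mul (by norm_num)]
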